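/- Let K be an algebraically closed field of characteristic zero and let k ≥ 0 be an integer. Then there exists a form F ∈ K[x,y,z] of degree 2k+2 with Waring rank rk F > k² + 3k + 2. -/

import Mathlib

open MvPolynomial

/-- The Waring rank of a ternary form `F` with respect to degree `d`:
the least `r` such that `F` is a linear combination of `r` `d`-th powers
of linear forms. -/
noncomputable def waringRank {K : Type*} [Field K] (d : ℕ)
    (F : MvPolynomial (Fin 3) K) : ℕ :=
  sInf {r : ℕ | ∃ (c : Fin r → K) (ℓ : Fin r → MvPolynomial (Fin 3) K),
    (∀ i, (ℓ i).IsHomogeneous 1) ∧ F = ∑ i, c i • ℓ i ^ d}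

/-- A relation on the affine points `(b p / a p, e p / a p)` between the monomials of bidegree at
most `(k, k + 1)` and the monomial of bidegree `(k + 1, 0)` has no term of total degree above
`k`, and is trivial if the latter monomial does not occur. -/
lemma eq_zero_of_box_relation {K ι : Type*} [Field K] [Fintype ι] {k : ℕ} {c a b e : ι → K}
    (hvanish : ∀ l m n, l + m + n = 2 * k + 2 → l ≠ 0 → ¬(l = 1 ∧ m = k ∧ n = k + 1) →
      ∑ p, c p * (a p ^ l * b p ^ m * e p ^ n) = 0)
    (hne : ∑ p, c p * (a p ^ 1 * b p ^ k * e p ^ (k + 1)) ≠ 0)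
    (t : K) (g : Fin (k + 1) × Fin (k + 2) → K)
    (hg : ∀ p, t * (a p ^ (k + 1) * b p ^ (k + 1)) =
      ∑ q, g q * (a p ^ (2 * k + 2 - (q.1 + q.2)) * b p ^ (q.1 : ℕ) * e p ^ (q.2 : ℕ)))
    (q : Fin (k + 1) × Fin (k + 2)) (hq : t = 0 ∨ k < q.1 + q.2) : g q = 0 := by
  classical
  by_contra hgq
  obtain ⟨⟨i, j⟩, hm, hmax⟩ := Finset.exists_max_image (Finset.univ.filter fun q => g q ≠ 0)
    (fun q => (q.1 + q.2 : ℕ)) ⟨q, by simpa using hgq⟩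
  simp only [Finset.mem_filter, Finset.mem_univ, true_and] at hm hmax
  have hi := i.isLt
  have hj := j.isLt
  have htop : t = 0 ∨ k < (i : ℕ) + j := hq.imp_right fun h => h.trans_le (hmax q hgq)
  -- Divide by a power of the first coordinate.
  have hdiv : ∀ p, t * (a p ^ ((i : ℕ) + j - k) * b p ^ (k + 1)) =
      ∑ q : Fin (k + 1) × Fin (k + 2),
        g q * (a p ^ ((i : ℕ) + j + 1 - (q.1 + q.2)) * b p ^ (q.1 : ℕ) * e p ^ (q.2 : ℕ)) := by
    intro p
    by_cases ha : a p = 0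
    · rw [Finset.sum_eq_zero]
      · rcases htop with h | h
        · simp [h]
        · rw [ha, zero_pow (by omega)]; simp
      · intro q _
        by_cases h : g q = 0
        · simp [h]
        · have := hmax q h
          rw [ha, zero_pow (by omega)]; simp
    · apply mul_left_cancel₀ (pow_ne_zero (2 * k + 1 - (i + j)) ha)
      rw [Finset.mul_sum]
      convert hg p using 1
      · rcases htop with h | h
        · simp [h]
        · rw [mul_left_comm, ← mul_assoc (a p ^ _), ← pow_add,
            show 2 * k + 1 - ((i : ℕ) + j) + ((i : ℕ) + j - k) = k + 1 by omega]
      · refine Finset.sum_congr rfl fun q _ => ?_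
        by_cases h : g q = 0
        · simp [h]
        · have := hmax q h
          rw [show 2 * k + 2 - ((q.1 : ℕ) + q.2) =
            (2 * k + 1 - ((i : ℕ) + j)) + ((i : ℕ) + j + 1 - (q.1 + q.2)) by omega, pow_add (a p)]
          ring
  have hsum : ∑ p, c p * (t * (a p ^ ((i : ℕ) + j - k) * b p ^ (k + 1)) *
      (b p ^ (k - i) * e p ^ (k + 1 - j))) = 0 := by
    rcases htop with h | h
    · simp [h]
    · rw [← mul_zero t, ← hvanish ((i : ℕ) + j - k) (k + 1 + (k - i)) (k + 1 - j) (by omega)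
        (by omega) (by omega), Finset.mul_sum]
      exact Finset.sum_congr rfl fun p _ => by ring
  have hswap : ∑ p, c p * (t * (a p ^ ((i : ℕ) + j - k) * b p ^ (k + 1)) *
      (b p ^ (k - i) * e p ^ (k + 1 - j))) = ∑ q : Fin (k + 1) × Fin (k + 2), g q *
        ∑ p, c p * (a p ^ ((i : ℕ) + j + 1 - (q.1 + q.2)) * b p ^ (q.1 + (k - i)) *
          e p ^ (q.2 + (k + 1 - j))) := by
    simp_rw [hdiv, Finset.mul_sum, Finset.sum_mul, Finset.mul_sum]
    rw [Finset.sum_comm]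
    exact Finset.sum_congr rfl fun q _ => Finset.sum_congr rfl fun p _ => by ring
  rw [hsum, Finset.sum_eq_single (i, j)] at hswap
  · rw [show (i : ℕ) + j + 1 - (i + j) = 1 by omega, show (i : ℕ) + (k - i) = k by omega,
      show (j : ℕ) + (k + 1 - j) = k + 1 by omega] at hswap
    exact mul_ne_zero hm hne hswap.symm
  · intro q _ hqne
    by_cases h : g q = 0
    · simp [h]
    · have := hmax q h
      rw [hvanish _ _ _ (by omega) (by omega), mul_zero]
      rintro ⟨-, h1, h2⟩
      exact hqne (Prod.ext (Fin.ext (by simp only; omega)) (Fin.ext (by simp only; omega)))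
  · simp

/-- A lower bound for the number of points supporting a functional on forms of degree `2 * k + 2`
whose only nonzero moments are those at `(1, k, k + 1)` and `(0, 2 * k + 2, 0)`. -/
lemma lt_card_of_moments {K ι : Type*} [Field K] [Fintype ι] {k : ℕ} {c a b e : ι → K}
    (hvanish : ∀ l m n, l + m + n = 2 * k + 2 → l ≠ 0 → ¬(l = 1 ∧ m = k ∧ n = k + 1) →
      ∑ p, c p * (a p ^ l * b p ^ m * e p ^ n) = 0)
    (hne : ∑ p, c p * (a p ^ 1 * b p ^ k * e p ^ (k + 1)) ≠ 0)
    (hne' : ∑ p, c p * (a p ^ 0 * b p ^ (2 * k + 2) * e p ^ 0) ≠ 0) :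
    k ^ 2 + 3 * k + 2 < Fintype.card ι := by
  let v : Fin (k + 1) × Fin (k + 2) → ι → K := fun q p =>
    a p ^ (2 * k + 2 - (q.1 + q.2 : ℕ)) * b p ^ (q.1 : ℕ) * e p ^ (q.2 : ℕ)
  have hcard : Fintype.card (Fin (k + 1) × Fin (k + 2)) = k ^ 2 + 3 * k + 2 := by
    simp only [Fintype.card_prod, Fintype.card_fin]; ring
  have hli : LinearIndependent K v := by
    rw [Fintype.linearIndependent_iff]
    intro g hg q
    refine eq_zero_of_box_relation hvanish hne 0 g (fun p => ?_) q (.inl rfl)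
    simpa [v] using (congrFun hg p).symm
  have hle := hli.fintype_card_le_finrank
  rw [Module.finrank_fintype_fun_eq_card, hcard] at hle
  refine lt_of_le_of_ne hle fun heq => ?_
  have hspan := hli.span_eq_top_of_card_eq_finrank'
    (by rw [Module.finrank_fintype_fun_eq_card, hcard, heq])
  have hrep (w : ι → K) : ∃ g : Fin (k + 1) × Fin (k + 2) → K, ∑ q, g q • v q = w :=
    (Submodule.mem_span_range_iff_exists_fun K).1 (hspan ▸ Submodule.mem_top)
  have ha (p : ι) : a p ≠ 0 := by
    intro h0
    obtain ⟨g, hg⟩ := hrep 1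
    have := congrFun hg p
    rw [Finset.sum_apply, Finset.sum_eq_zero] at this
    · simp at this
    · intro q _
      simp only [v, Pi.smul_apply, h0]
      rw [zero_pow (by omega)]; simp
  obtain ⟨g, hg⟩ := hrep fun p => a p ^ (k + 1) * b p ^ (k + 1)
  have hlow (q) (hq : k < (q.1 + q.2 : ℕ)) : g q = 0 := by
    refine eq_zero_of_box_relation hvanish hne 1 g (fun p => ?_) q (.inr hq)
    simpa [v] using (congrFun hg p).symm
  have hdiv (p : ι) : b p ^ (k + 1) = ∑ q : Fin (k + 1) × Fin (k + 2),
      g q * (a p ^ (k + 1 - (q.1 + q.2 : ℕ)) * b p ^ (q.1 : ℕ) * e p ^ (q.2 : ℕ)) := by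
    apply mul_left_cancel₀ (pow_ne_zero (k + 1) (ha p))
    rw [← congrFun hg p, Finset.sum_apply, Finset.mul_sum]
    refine Finset.sum_congr rfl fun q _ => ?_
    by_cases h : k < (q.1 + q.2 : ℕ)
    · simp [hlow q h]
    · simp only [v, Pi.smul_apply, smul_eq_mul]
      rw [show 2 * k + 2 - ((q.1 : ℕ) + q.2) = (k + 1) + (k + 1 - (q.1 + q.2)) by omega,
        pow_add (a p)]
      ring
  have hswap : ∑ p, c p * (a p ^ 0 * b p ^ (2 * k + 2) * e p ^ 0) =
      ∑ q : Fin (k + 1) × Fin (k + 2), g q *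
        ∑ p, c p * (a p ^ (k + 1 - (q.1 + q.2 : ℕ)) * b p ^ (q.1 + (k + 1)) * e p ^ (q.2 : ℕ)) := by
    have (p : ι) : a p ^ 0 * b p ^ (2 * k + 2) * e p ^ 0 = b p ^ (k + 1) * b p ^ (k + 1) := by ring
    have hterm (p : ι) : c p * (a p ^ 0 * b p ^ (2 * k + 2) * e p ^ 0) =
        ∑ q : Fin (k + 1) × Fin (k + 2), g q * (c p *
          (a p ^ (k + 1 - (q.1 + q.2 : ℕ)) * b p ^ (q.1 + (k + 1)) * e p ^ (q.2 : ℕ))) := by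
      rw [this]
      nth_rewrite 1 [hdiv p]
      rw [Finset.sum_mul, Finset.mul_sum]
      exact Finset.sum_congr rfl fun q _ => by ring
    simp_rw [hterm, Finset.mul_sum]
    exact Finset.sum_comm
  refine hne' (hswap.trans (Finset.sum_eq_zero fun q _ => ?_))
  by_cases h : k < (q.1 + q.2 : ℕ)
  · simp [hlow q h]
  · rw [hvanish _ _ _ (by omega) (by omega) (by omega), mul_zero]

/-- If all values of a polynomial function with vector coefficients lie in a subspace, so do the
coefficients. -/
lemma mem_of_forall_sum_pow_smul_mem {K V : Type*} [Field K] [Infinite K] [AddCommGroup V]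
    [Module K V] {W : Submodule K V} {n : ℕ} {v : ℕ → V}
    (h : ∀ t : K, ∑ i ∈ Finset.range n, t ^ i • v i ∈ W) {j : ℕ} (hj : j < n) : v j ∈ W := by
  by_contra hv
  obtain ⟨f, hf, hW⟩ := Submodule.exists_le_ker_of_notMem hv
  have hzero : ∑ i ∈ Finset.range n, Polynomial.C (f (v i)) * Polynomial.X ^ i = 0 := by
    refine Polynomial.funext fun t => ?_
    have hker : f (∑ i ∈ Finset.range n, t ^ i • v i) = 0 := hW (h t)
    rw [map_sum] at hker
    rw [Polynomial.eval_finsetSum, Polynomial.eval_zero, ← hker]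
    refine Finset.sum_congr rfl fun i _ => ?_
    rw [Polynomial.eval_mul, Polynomial.eval_C, Polynomial.eval_pow, Polynomial.eval_X, map_smul,
      smul_eq_mul, mul_comm]
  have hcoeff := congrArg (fun P => P.coeff j) hzero
  simp only [Polynomial.finsetSum_coeff, Polynomial.coeff_C_mul, Polynomial.coeff_X_pow, mul_ite,
    mul_one, mul_zero, Finset.sum_ite_eq, Finset.mem_range, hj, if_true,
    Polynomial.coeff_zero] at hcoeff
  exact hf hcoeff

/-- If a submodule contains all values of `(u + t • w) ^ n * z`, it contains all the products
`w ^ j * u ^ (n - j) * z`. -/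
lemma pow_mul_pow_mul_mem {K A : Type*} [Field K] [CharZero K] [CommRing A] [Algebra K A]
    {W : Submodule K A} {n : ℕ} {u w z : A} (h : ∀ t : K, z * (t • w + u) ^ n ∈ W) {j : ℕ}
    (hj : j ≤ n) : z * (w ^ j * u ^ (n - j)) ∈ W := by
  have key := mem_of_forall_sum_pow_smul_mem (K := K) (W := W) (n := n + 1)
    (v := fun i => (n.choose i : K) • (z * (w ^ i * u ^ (n - i)))) (fun t => ?_)
    (Nat.lt_succ_of_le hj)
  · exact (W.smul_mem_iff (Nat.cast_ne_zero.2 (Nat.choose_pos hj).ne')).1 key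
  · convert h t using 1
    rw [add_pow, Finset.mul_sum]
    refine Finset.sum_congr rfl fun i _ => ?_
    simp only [Algebra.smul_def, map_natCast, map_pow, mul_pow]
    ring

/-- The ternary form `x * y ^ k * z ^ (k + 1) + y ^ (2 * k + 2)`. -/
noncomputable def highRankForm (K : Type*) [Field K] (k : ℕ) : MvPolynomial (Fin 3) K :=
  X 0 * (X 1 ^ k * X 2 ^ (k + 1)) + X 1 ^ (2 * k + 2)

lemma isHomogeneous_highRankForm (K : Type*) [Field K] (k : ℕ) :
    (highRankForm K k).IsHomogeneous (2 * k + 2) := by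
  refine .add ?_ (isHomogeneous_X_pow _ _)
  convert (isHomogeneous_X K (0 : Fin 3)).mul
    ((isHomogeneous_X_pow (1 : Fin 3) k).mul (isHomogeneous_X_pow (2 : Fin 3) (k + 1))) using 1
  ring

lemma exists_decomposition_highRankForm (K : Type*) [Field K] [CharZero K] (k : ℕ) :
    ∃ (r : ℕ) (c : Fin r → K) (ℓ : Fin r → MvPolynomial (Fin 3) K),
      (∀ i, (ℓ i).IsHomogeneous 1) ∧ highRankForm K k = ∑ i, c i • ℓ i ^ (2 * k + 2) := by
  let S : Set (MvPolynomial (Fin 3) K) := {p | ∃ ℓ, ℓ.IsHomogeneous 1 ∧ ℓ ^ (2 * k + 2) = p}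
  have hX (i : Fin 3) : (X i : MvPolynomial (Fin 3) K).IsHomogeneous 1 := isHomogeneous_X K i
  have hsmul (t : K) {p : MvPolynomial (Fin 3) K} (hp : p.IsHomogeneous 1) :
      (t • p).IsHomogeneous 1 := (homogeneousSubmodule (Fin 3) K 1).smul_mem t hp
  have hpow {p : MvPolynomial (Fin 3) K} (hp : p.IsHomogeneous 1) :
      p ^ (2 * k + 2) ∈ Submodule.span K S := Submodule.subset_span ⟨p, hp, rfl⟩
  have hmem : highRankForm K k ∈ Submodule.span K S := by
    refine add_mem ?_ (hpow (hX 1))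
    have hstep (s : K) :
        (X 0 : MvPolynomial (Fin 3) K) * (s • X 1 + X 2) ^ (2 * k + 1) ∈ Submodule.span K S := by
      have := pow_mul_pow_mul_mem (K := K) (W := Submodule.span K S) (n := 2 * k + 2) (z := 1)
        (w := X 0) (u := s • X 1 + X 2) (j := 1) (fun t => ?_) (by omega)
      · simpa using this
      · rw [one_mul]
        exact hpow ((hsmul t (hX 0)).add ((hsmul s (hX 1)).add (hX 2)))
    have := pow_mul_pow_mul_mem hstep (j := k) (by omega)
    rwa [show 2 * k + 1 - k = k + 1 by omega] at this
  obtain ⟨r, c, s, hs⟩ := Submodule.mem_span_set'.1 hmem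
  choose ℓ hℓ hℓs using fun i => (s i).2
  exact ⟨r, c, ℓ, hℓ, by simp only [← hs, ← hℓs]⟩

lemma moment_mul_multinomial {K ι : Type*} [Field K] [Fintype ι] (d : ℕ) (c : ι → K)
    (a : ι → Fin 3 → K) (s : Fin 3 →₀ ℕ) (hs : s 0 + s 1 + s 2 = d) :
    coeff s (∑ p, c p • (∑ i, a p i • X i : MvPolynomial (Fin 3) K) ^ d) =
      s.multinomial * ∑ p, c p * (a p 0 ^ s 0 * a p 1 ^ s 1 * a p 2 ^ s 2) := by
  rw [coeff_sum, Finset.mul_sum]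
  refine Finset.sum_congr rfl fun p _ => ?_
  rw [coeff_smul, coeff_linearCombination_X_pow_of_fintype, if_pos, smul_eq_mul,
    Finsupp.prod_fintype _ _ (by simp), Fin.prod_univ_three]
  · ring
  · rw [Finsupp.sum_fintype _ _ (by simp), Fin.sum_univ_three, hs]

lemma coeff_highRankForm (K : Type*) [Field K] (k : ℕ) (s : Fin 3 →₀ ℕ) :
    coeff s (highRankForm K k) = (if s 0 = 1 ∧ s 1 = k ∧ s 2 = k + 1 then 1 else 0) +
      if s 0 = 0 ∧ s 1 = 2 * k + 2 ∧ s 2 = 0 then 1 else 0 := by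
  have h : highRankForm K k = monomial (Finsupp.equivFunOnFinite.symm ![1, k, k + 1]) 1 +
      monomial (Finsupp.equivFunOnFinite.symm ![0, 2 * k + 2, 0]) 1 := by
    simp [highRankForm, monomial_eq, Finsupp.prod_fintype, Fin.prod_univ_three, mul_assoc]
  rw [h, coeff_add, coeff_monomial, coeff_monomial]
  congr 2 <;> simp [Finsupp.ext_iff, Fin.forall_fin_succ, eq_comm]

lemma lt_of_decomposition_highRankForm {K : Type*} [Field K] [CharZero K] {k r : ℕ}
    {c : Fin r → K} {ℓ : Fin r → MvPolynomial (Fin 3) K} (hℓ : ∀ i, (ℓ i).IsHomogeneous 1)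
    (hF : highRankForm K k = ∑ i, c i • ℓ i ^ (2 * k + 2)) : k ^ 2 + 3 * k + 2 < r := by
  have hlin (p : Fin r) : ∃ a : Fin 3 → K, ∑ i, a i • X i = ℓ p := by
    rw [← Submodule.mem_span_range_iff_exists_fun, ← homogeneousSubmodule_one_eq_span_X]
    exact hℓ p
  choose a ha using hlin
  have hmoment (l m n : ℕ) (h : l + m + n = 2 * k + 2) :
      (Finsupp.multinomial (Finsupp.equivFunOnFinite.symm ![l, m, n]) : K) *
        ∑ p, c p * (a p 0 ^ l * a p 1 ^ m * a p 2 ^ n) =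
      (if l = 1 ∧ m = k ∧ n = k + 1 then 1 else 0) +
        if l = 0 ∧ m = 2 * k + 2 ∧ n = 0 then 1 else 0 := by
    have key := moment_mul_multinomial (2 * k + 2) c a
      (Finsupp.equivFunOnFinite.symm ![l, m, n]) (by simpa using h)
    simp only [ha, ← hF, coeff_highRankForm] at key
    simpa using key.symm
  have hmult (s : Fin 3 →₀ ℕ) : (s.multinomial : K) ≠ 0 :=
    Nat.cast_ne_zero.2 (Nat.multinomial_pos _ _).ne'
  rw [← Fintype.card_fin r]
  refine lt_card_of_moments (c := c) (a := (a · 0)) (b := (a · 1)) (e := (a · 2)) ?_ ?_ ?_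
  · intro l m n h hl hne
    have := hmoment l m n h
    rw [if_neg hne, if_neg (by omega), add_zero] at this
    exact (mul_eq_zero.1 this).resolve_left (hmult _)
  · intro h
    have := hmoment 1 k (k + 1) (by omega)
    rw [h] at this
    simp at this
  · intro h
    have := hmoment 0 (2 * k + 2) 0 (by omega)
    rw [h] at this
    simp at this

theorem exists_high_rank_even_degree (K : Type*) [Field K] [IsAlgClosed K] [CharZero K]
    (k : ℕ) :
    ∃ F : MvPolynomial (Fin 3) K, F.IsHomogeneous (2 * k + 2) ∧
      k ^ 2 + 3 * k + 2 < waringRank (2 * k + 2) F := by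
  refine ⟨highRankForm K k, isHomogeneous_highRankForm K k, ?_⟩
  obtain ⟨c, ℓ, hℓ, hF⟩ := Nat.sInf_mem (exists_decomposition_highRankForm K k)
  exact lt_of_decomposition_highRankForm hℓ hF
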